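/- Let d ≥ 1, T > 0, and let α, ν > 0 with α + ν < 1. There exists a constant c > 0 such that for every differentiable function h : ℝ^d → ℝ whose gradient ∇h is bounded and (α+ν)-Hölder, and for all 0 ≤ t ≤ t + ε ≤ T: |(P_{t+ε} h)(0) − (P_t h)(0)| + ‖∇(P_{t+ε} h) − ∇(P_t h)‖_∞ + [∇(P_{t+ε} h) − ∇(P_t h)]_α ≤ c · ε^{(ν ∧ 1)/2} · ( ‖∇h‖_∞ + [∇h]_{α+ν} ). In particular, t ↦ P_t h is continuous from [0,T] into D𝒞^α. -/

import Mathlib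

open MeasureTheory

/-- The heat kernel `p_t(x) = (2πt)^{-d/2} exp(-‖x‖²/(2t))` on `ℝ^d`. -/
noncomputable def heatKernel (d : ℕ) (t : ℝ) (x : EuclideanSpace ℝ (Fin d)) : ℝ :=
  (2 * Real.pi * t) ^ (-(d : ℝ) / 2) * Real.exp (-‖x‖ ^ 2 / (2 * t))

/-- The heat semigroup `P_t h (x) = ∫ p_t(x-y) h(y) dy` for `t > 0`, with `P_0 h = h`. -/
noncomputable def heatSemigroup (d : ℕ) (t : ℝ) (h : EuclideanSpace ℝ (Fin d) → ℝ)
    (x : EuclideanSpace ℝ (Fin d)) : ℝ :=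
  if t = 0 then h x else ∫ y, heatKernel d t (x - y) * h y

/-- The supremum norm `‖g‖_∞ = ⨆ x, ‖g x‖` of a function. -/
noncomputable def supNorm {E F : Type*} [NormedAddCommGroup F] (g : E → F) : ℝ :=
  ⨆ x, ‖g x‖

/-- The `γ`-Hölder seminorm `[g]_γ = sup_{x ≠ y} ‖g x - g y‖ / ‖x - y‖^γ`. -/
noncomputable def holderSem {E F : Type*} [NormedAddCommGroup E] [NormedAddCommGroup F]
    (γ : ℝ) (g : E → F) : ℝ :=
  sSup {r : ℝ | ∃ x y : E, x ≠ y ∧ r = ‖g x - g y‖ / ‖x - y‖ ^ γ}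

namespace HeatAux

/-- The standard Gaussian density. -/
noncomputable def G (d : ℕ) (z : EuclideanSpace ℝ (Fin d)) : ℝ := heatKernel d 1 z

lemma G_nonneg (d : ℕ) (z : EuclideanSpace ℝ (Fin d)) : 0 ≤ G d z := by
  unfold G heatKernel; positivity

lemma G_cont (d : ℕ) : Continuous (G d) := by
  unfold G heatKernel; fun_prop

lemma integrable_exp (d : ℕ) {b : ℝ} (hb : 0 < b) :
    Integrable (fun v : EuclideanSpace ℝ (Fin d) => Real.exp (-b * ‖v‖ ^ 2)) := by
  have h := GaussianFourier.integral_rexp_neg_mul_sq_norm (V := EuclideanSpace ℝ (Fin d)) hb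
  by_contra hc
  rw [integral_undef hc] at h
  have : 0 < (Real.pi / b) ^ ((Module.finrank ℝ (EuclideanSpace ℝ (Fin d)) : ℝ) / 2) := by
    positivity
  linarith

lemma G_int (d : ℕ) : Integrable (fun z => G d z * (1 + ‖z‖)) := by
  have h := (integrable_exp d (b := 1 / 4) (by norm_num)).const_mul
    ((2 * Real.pi * 1) ^ (-(d : ℝ) / 2) * 3)
  refine h.mono' ?_ (Filter.Eventually.of_forall fun z => ?_)
  · exact ((G_cont d).mul (by fun_prop)).aestronglyMeasurable
  · rw [Real.norm_of_nonneg (mul_nonneg (G_nonneg d z) (by positivity))]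
    unfold G heatKernel
    generalize hA : (2 * Real.pi * 1) ^ (-(d : ℝ) / 2) = A
    have hA0 : 0 ≤ A := hA ▸ by positivity
    rw [mul_assoc, mul_assoc]
    refine mul_le_mul_of_nonneg_left ?_ (by positivity)
    have e : Real.exp (-‖z‖ ^ 2 / (2 * 1)) = Real.exp (-(1/4) * ‖z‖ ^ 2) *
        Real.exp (-(1/4) * ‖z‖ ^ 2) := by
      rw [← Real.exp_add]; congr 1; ring
    have h1 : Real.exp (-(1/4) * ‖z‖ ^ 2) * (1 + ‖z‖) ≤ 3 := by
      have h2 : 1 + ‖z‖ ≤ 3 * Real.exp ((1/4) * ‖z‖ ^ 2) := by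
        have := Real.add_one_le_exp ((1/4) * ‖z‖ ^ 2)
        nlinarith [sq_nonneg (‖z‖ - 1)]
      calc _ ≤ Real.exp (-(1/4) * ‖z‖ ^ 2) * (3 * Real.exp ((1/4) * ‖z‖ ^ 2)) :=
            mul_le_mul_of_nonneg_left h2 (Real.exp_pos _).le
        _ = 3 * Real.exp (-(1/4) * ‖z‖ ^ 2 + (1/4) * ‖z‖ ^ 2) := by
            rw [Real.exp_add]; ring
        _ = 3 := by simp
    rw [e]
    nlinarith [Real.exp_pos (-(1/4) * ‖z‖ ^ 2)]

/-- Moment constant. -/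
noncomputable def M (d : ℕ) : ℝ := ∫ z, G d z * (1 + ‖z‖)

lemma M_nonneg (d : ℕ) : 0 ≤ M d :=
  integral_nonneg fun z => mul_nonneg (G_nonneg d z) (by positivity)

/-- Any integrand bounded by `B * G z * (1 + ‖z‖)`. -/
lemma norm_int_le (d : ℕ) {F : Type*} [NormedAddCommGroup F] [NormedSpace ℝ F] {B : ℝ}
    (f : EuclideanSpace ℝ (Fin d) → F)
    (hf : ∀ z, ‖f z‖ ≤ B * (G d z * (1 + ‖z‖))) : ‖∫ z, f z‖ ≤ B * M d := by
  rw [M, ← integral_const_mul]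
  exact norm_integral_le_of_norm_le ((G_int d).const_mul B) (Filter.Eventually.of_forall hf)

lemma int_of_le (d : ℕ) {F : Type*} [NormedAddCommGroup F] {B : ℝ}
    (f : EuclideanSpace ℝ (Fin d) → F) (hc : Continuous f)
    (hf : ∀ z, ‖f z‖ ≤ B * (G d z * (1 + ‖z‖))) : Integrable f :=
  ((G_int d).const_mul B).mono' hc.aestronglyMeasurable (Filter.Eventually.of_forall hf)

lemma integral_G (d : ℕ) : ∫ z, G d z = 1 := by
  have h := GaussianFourier.integral_rexp_neg_mul_sq_norm (V := EuclideanSpace ℝ (Fin d))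
    (b := 1 / 2) (by norm_num)
  have e : ∀ z : EuclideanSpace ℝ (Fin d), G d z =
      (2 * Real.pi * 1) ^ (-(d : ℝ) / 2) * Real.exp (-(1/2) * ‖z‖ ^ 2) := by
    intro z; unfold G heatKernel; congr 2; ring
  simp_rw [e]
  rw [integral_const_mul, h, finrank_euclideanSpace_fin,
    show Real.pi / (1/2) = 2 * Real.pi * 1 by ring, ← Real.rpow_add (by positivity)]
  rw [show -(d : ℝ) / 2 + d / 2 = 0 by ring, Real.rpow_zero]

lemma heat_eq (d : ℕ) {t : ℝ} (ht : 0 ≤ t) (h : EuclideanSpace ℝ (Fin d) → ℝ)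
    (x : EuclideanSpace ℝ (Fin d)) :
    heatSemigroup d t h x = ∫ z, G d z * h (x - √t • z) := by
  rcases ht.eq_or_lt with rfl | ht
  · simp [heatSemigroup, integral_mul_const, integral_G]
  · rw [heatSemigroup, if_neg ht.ne']
    have h1 : ∫ y, heatKernel d t (x - y) * h y = ∫ w, heatKernel d t w * h (x - w) := by
      rw [← integral_sub_left_eq_self _ _ x]
      simp
    have h2 := Measure.integral_comp_smul (volume : Measure (EuclideanSpace ℝ (Fin d)))
      (fun w => heatKernel d t w * h (x - w)) (√t)
    have hs : 0 < √t := Real.sqrt_pos.2 ht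
    have hp : 0 < √t ^ d := by positivity
    rw [finrank_euclideanSpace_fin, abs_of_pos (by positivity), smul_eq_mul,
      eq_inv_mul_iff_mul_eq₀ hp.ne', ← integral_const_mul] at h2
    rw [h1, ← h2]
    congr 1
    ext z
    rw [← mul_assoc]
    congr 1
    unfold G heatKernel
    rw [norm_smul, Real.norm_of_nonneg hs.le, mul_pow, Real.sq_sqrt ht.le, ← mul_assoc]
    congr 1
    · rw [show 2 * Real.pi * t = (2 * Real.pi * 1) * t by ring,
        Real.mul_rpow (by positivity) ht.le, mul_left_comm]
      have : √t ^ d * t ^ (-(d : ℝ) / 2) = 1 := by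
        rw [← Real.rpow_natCast, Real.sqrt_eq_rpow, ← Real.rpow_mul ht.le,
          ← Real.rpow_add ht, show 1 / 2 * (d : ℝ) + -(d : ℝ) / 2 = 0 by ring, Real.rpow_zero]
      rw [this, mul_one]
    · congr 1; field_simp

lemma norm_grad_sub (d : ℕ) (f g : EuclideanSpace ℝ (Fin d) → ℝ)
    (x y : EuclideanSpace ℝ (Fin d)) :
    ‖gradient f x - gradient g y‖ = ‖fderiv ℝ f x - fderiv ℝ g y‖ := by
  unfold gradient
  rw [← map_sub, LinearIsometryEquiv.norm_map]

lemma norm_grad (d : ℕ) (f : EuclideanSpace ℝ (Fin d) → ℝ) (x : EuclideanSpace ℝ (Fin d)) :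
    ‖gradient f x‖ = ‖fderiv ℝ f x‖ := by
  unfold gradient
  rw [LinearIsometryEquiv.norm_map]

variable {d : ℕ} {h : EuclideanSpace ℝ (Fin d) → ℝ} {K : ℝ}

lemma lip (hd : Differentiable ℝ h) (hK : ∀ x, ‖fderiv ℝ h x‖ ≤ K)
    (x y : EuclideanSpace ℝ (Fin d)) : ‖h x - h y‖ ≤ K * ‖x - y‖ :=
  convex_univ.norm_image_sub_le_of_norm_fderiv_le (𝕜 := ℝ) (fun z _ => hd z)
    (fun z _ => hK z) (Set.mem_univ y) (Set.mem_univ x)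

lemma int_h (hd : Differentiable ℝ h) (hK : ∀ x, ‖fderiv ℝ h x‖ ≤ K) (r : ℝ)
    (x : EuclideanSpace ℝ (Fin d)) : Integrable (fun z => G d z * h (x - r • z)) := by
  have hK0 : 0 ≤ K := (norm_nonneg _).trans (hK 0)
  refine int_of_le d (B := ‖h x‖ + K * |r|) _
    ((G_cont d).mul (hd.continuous.comp (by fun_prop))) fun z => ?_
  rw [norm_mul, Real.norm_of_nonneg (G_nonneg d z), mul_left_comm]
  refine mul_le_mul_of_nonneg_left ?_ (G_nonneg d z)
  have h1 := lip hd hK (x - r • z) x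
  have h2 : ‖x - r • z - x‖ = |r| * ‖z‖ := by
    rw [sub_sub_cancel_left, norm_neg, norm_smul, Real.norm_eq_abs]
  rw [h2] at h1
  have h3 : ‖h (x - r • z)‖ ≤ ‖h x‖ + ‖h (x - r • z) - h x‖ := by
    have := norm_add_le (h x) (h (x - r • z) - h x)
    rwa [add_sub_cancel] at this
  nlinarith [norm_nonneg (h x), norm_nonneg z, abs_nonneg r, mul_nonneg hK0 (abs_nonneg r),
    mul_nonneg (norm_nonneg (h x)) (norm_nonneg z)]

lemma int_h' (hK : ∀ x, ‖fderiv ℝ h x‖ ≤ K) (hc : Continuous (fderiv ℝ h)) (r : ℝ)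
    (x : EuclideanSpace ℝ (Fin d)) : Integrable (fun z => G d z • fderiv ℝ h (x - r • z)) := by
  have hK0 : 0 ≤ K := (norm_nonneg _).trans (hK 0)
  refine int_of_le d (B := K) _ ((G_cont d).smul (hc.comp (by fun_prop))) fun z => ?_
  rw [norm_smul, Real.norm_of_nonneg (G_nonneg d z), mul_left_comm]
  refine mul_le_mul_of_nonneg_left ?_ (G_nonneg d z)
  nlinarith [hK (x - r • z), mul_nonneg hK0 (norm_nonneg z)]

lemma fderiv_heat (hd : Differentiable ℝ h) (hK : ∀ x, ‖fderiv ℝ h x‖ ≤ K)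
    (hc : Continuous (fderiv ℝ h)) {t : ℝ} (ht : 0 ≤ t) (x : EuclideanSpace ℝ (Fin d)) :
    fderiv ℝ (heatSemigroup d t h) x = ∫ z, G d z • fderiv ℝ h (x - √t • z) := by
  have hK0 : 0 ≤ K := (norm_nonneg _).trans (hK 0)
  have e : heatSemigroup d t h = fun x => ∫ z, G d z * h (x - √t • z) := by
    ext x; exact heat_eq d ht h x
  rw [e]
  refine HasFDerivAt.fderiv ?_
  refine hasFDerivAt_integral_of_dominated_of_fderiv_le (𝕜 := ℝ)
    (F' := fun x z => G d z • fderiv ℝ h (x - √t • z))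
    (bound := fun z => K * (G d z * (1 + ‖z‖))) (s := Set.univ) Filter.univ_mem
    (Filter.Eventually.of_forall fun y => (int_h hd hK _ y).aestronglyMeasurable)
    (int_h hd hK _ x) (int_h' hK hc _ x).aestronglyMeasurable ?_ ((G_int d).const_mul K) ?_
  · refine Filter.Eventually.of_forall fun z y _ => ?_
    rw [norm_smul, Real.norm_of_nonneg (G_nonneg d z), mul_left_comm]
    refine mul_le_mul_of_nonneg_left ?_ (G_nonneg d z)
    nlinarith [hK (y - √t • z), mul_nonneg hK0 (norm_nonneg z)]
  · refine Filter.Eventually.of_forall fun z y _ => ?_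
    have h1 : HasFDerivAt (fun y => h (y - √t • z)) (fderiv ℝ h (y - √t • z)) y := by
      rw [hasFDerivAt_comp_sub]
      exact (hd _).hasFDerivAt
    exact h1.const_mul (G d z)

lemma abs_sqrt_sub {s t : ℝ} (hs : 0 ≤ s) (ht : 0 ≤ t) : |√s - √t| ≤ √|s - t| := by
  apply Real.le_sqrt_of_sq_le
  have h1 : |s - t| = |√s - √t| * |√s + √t| := by
    rw [← abs_mul]; congr 1; nlinarith [Real.sq_sqrt hs, Real.sq_sqrt ht]
  rw [h1, sq]
  refine mul_le_mul_of_nonneg_left ?_ (abs_nonneg _)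
  rw [abs_of_nonneg (add_nonneg (Real.sqrt_nonneg s) (Real.sqrt_nonneg t)), abs_le]
  constructor <;> linarith [Real.sqrt_nonneg s, Real.sqrt_nonneg t]

lemma rpow_le_one_add {r γ : ℝ} (hr : 0 ≤ r) (h0 : 0 ≤ γ) (h1 : γ ≤ 1) : r ^ γ ≤ 1 + r := by
  rcases le_total r 1 with h | h
  · linarith [Real.rpow_le_one hr h h0]
  · have := Real.rpow_le_rpow_of_exponent_le h h1
    rw [Real.rpow_one] at this
    linarith

lemma rpow_split {δ T a b : ℝ} (hδ : 0 ≤ δ) (hT : δ ≤ T) (ha : 0 < a) (hb : 0 < b) :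
    δ ^ (a + b) ≤ T ^ b * δ ^ a := by
  rw [Real.rpow_add_of_nonneg hδ ha.le hb.le, mul_comm]
  exact mul_le_mul_of_nonneg_right (Real.rpow_le_rpow hδ hT hb.le) (Real.rpow_nonneg hδ _)

lemma main (d : ℕ) (T α ν : ℝ) (hα : 0 < α) (hν : 0 < ν) (hαν : α + ν < 1)
    {h : EuclideanSpace ℝ (Fin d) → ℝ} {K H : ℝ} (hd : Differentiable ℝ h)
    (hK : ∀ x, ‖fderiv ℝ h x‖ ≤ K) (hH0 : 0 ≤ H)
    (hH : ∀ x y, ‖fderiv ℝ h x - fderiv ℝ h y‖ ≤ H * ‖x - y‖ ^ (α + ν))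
    {s t : ℝ} (hs : 0 ≤ s) (ht : 0 ≤ t) (hst : |s - t| ≤ T) :
    |heatSemigroup d s h 0 - heatSemigroup d t h 0|
            + supNorm (fun x => gradient (heatSemigroup d s h) x
                - gradient (heatSemigroup d t h) x)
            + holderSem α (fun x => gradient (heatSemigroup d s h) x
                - gradient (heatSemigroup d t h) x)
     ≤ (M d * (T ^ ((1 - ν) / 2) + T ^ (α / 2) + 2) + 1) * |s - t| ^ (ν / 2) * (K + H) := by
  have hM := M_nonneg d
  have hK0 : 0 ≤ K := (norm_nonneg _).trans (hK 0)
  have hc : Continuous (fderiv ℝ h) := by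
    rw [continuous_iff_continuousAt]
    intro x
    rw [ContinuousAt, tendsto_iff_norm_sub_tendsto_zero]
    refine squeeze_zero (fun _ => norm_nonneg _) (fun y => hH y x) ?_
    have : Continuous fun y : EuclideanSpace ℝ (Fin d) => H * ‖y - x‖ ^ (α + ν) :=
      continuous_const.mul (Continuous.rpow_const (by fun_prop) fun _ => Or.inr (by linarith))
    have h2 := this.tendsto x
    simpa [Real.zero_rpow (by linarith : α + ν ≠ 0)] using h2
  set δ := |s - t| with hδ
  have hδ0 : 0 ≤ δ := abs_nonneg _
  have hT0 : 0 ≤ T := hδ0.trans hst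
  have hsq := abs_sqrt_sub hs ht
  rw [← hδ] at hsq
  have hdist : ∀ x z : EuclideanSpace ℝ (Fin d), ‖(x - √s • z) - (x - √t • z)‖ ≤ √δ * ‖z‖ := by
    intro x z
    have : (x - √s • z) - (x - √t • z) = -((√s - √t) • z) := by rw [sub_smul]; abel
    rw [this, norm_neg, norm_smul, Real.norm_eq_abs]
    exact mul_le_mul_of_nonneg_right hsq (norm_nonneg z)
  -- first term
  have t1 : |heatSemigroup d s h 0 - heatSemigroup d t h 0| ≤
      K * (T ^ ((1 - ν) / 2) * δ ^ (ν / 2)) * M d := by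
    rw [heat_eq d hs, heat_eq d ht, ← integral_sub (int_h hd hK _ _) (int_h hd hK _ _),
      ← Real.norm_eq_abs]
    have b : √δ ≤ T ^ ((1 - ν) / 2) * δ ^ (ν / 2) := by
      rw [Real.sqrt_eq_rpow, show (1 : ℝ) / 2 = ν / 2 + (1 - ν) / 2 by ring]
      exact rpow_split hδ0 hst (by linarith) (by linarith)
    refine (norm_int_le d (B := K * √δ) _ fun z => ?_).trans
      (mul_le_mul_of_nonneg_right (mul_le_mul_of_nonneg_left b hK0) hM)
    rw [← mul_sub, norm_mul, Real.norm_of_nonneg (G_nonneg d z), mul_left_comm]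
    refine mul_le_mul_of_nonneg_left ?_ (G_nonneg d z)
    refine (lip hd hK _ _).trans ?_
    rw [mul_assoc]
    refine mul_le_mul_of_nonneg_left ((hdist 0 z).trans ?_) hK0
    exact mul_le_mul_of_nonneg_left (by linarith) (Real.sqrt_nonneg _)
  have hsγ : √δ ^ (α + ν) = δ ^ ((α + ν) / 2) := by
    rw [Real.sqrt_eq_rpow, ← Real.rpow_mul hδ0]; congr 1; ring
  have e2 : ∀ x, fderiv ℝ (heatSemigroup d s h) x - fderiv ℝ (heatSemigroup d t h) x =
      ∫ z, G d z • (fderiv ℝ h (x - √s • z) - fderiv ℝ h (x - √t • z)) := by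
    intro x
    rw [fderiv_heat hd hK hc hs, fderiv_heat hd hK hc ht,
      ← integral_sub (int_h' hK hc _ _) (int_h' hK hc _ _)]
    simp_rw [smul_sub]
  have t2 : ∀ x, ‖fderiv ℝ (heatSemigroup d s h) x - fderiv ℝ (heatSemigroup d t h) x‖ ≤
      H * δ ^ ((α + ν) / 2) * M d := by
    intro x
    rw [e2]
    refine norm_int_le d _ fun z => ?_
    rw [norm_smul, Real.norm_of_nonneg (G_nonneg d z), mul_left_comm]
    refine mul_le_mul_of_nonneg_left ((hH _ _).trans ?_) (G_nonneg d z)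
    rw [mul_assoc]
    refine mul_le_mul_of_nonneg_left ?_ hH0
    refine (Real.rpow_le_rpow (norm_nonneg _) (hdist x z) (by linarith)).trans ?_
    rw [Real.mul_rpow (Real.sqrt_nonneg _) (norm_nonneg _), hsγ]
    exact mul_le_mul_of_nonneg_left (rpow_le_one_add (norm_nonneg z) (by linarith) hαν.le)
      (Real.rpow_nonneg hδ0 _)
  have t3 : ∀ r, 0 ≤ r → ∀ x y, ‖fderiv ℝ (heatSemigroup d r h) x -
      fderiv ℝ (heatSemigroup d r h) y‖ ≤ H * ‖x - y‖ ^ (α + ν) * M d := by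
    intro r hr x y
    rw [fderiv_heat hd hK hc hr, fderiv_heat hd hK hc hr,
      ← integral_sub (int_h' hK hc _ _) (int_h' hK hc _ _)]
    refine norm_int_le d _ fun z => ?_
    rw [← smul_sub, norm_smul, Real.norm_of_nonneg (G_nonneg d z), mul_left_comm]
    refine mul_le_mul_of_nonneg_left ((hH _ _).trans ?_) (G_nonneg d z)
    rw [sub_sub_sub_cancel_right]
    have : 0 ≤ H * ‖x - y‖ ^ (α + ν) := by positivity
    nlinarith [mul_nonneg this (norm_nonneg z)]
  have s2 : supNorm (fun x => gradient (heatSemigroup d s h) x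
                - gradient (heatSemigroup d t h) x) ≤
      H * (T ^ (α / 2) * δ ^ (ν / 2)) * M d := by
    refine ciSup_le fun x => ?_
    rw [norm_grad_sub]
    refine (t2 x).trans (mul_le_mul_of_nonneg_right (mul_le_mul_of_nonneg_left ?_ hH0) hM)
    rw [show (α + ν) / 2 = ν / 2 + α / 2 by ring]
    exact rpow_split hδ0 hst (by linarith) (by linarith)
  have s3 : holderSem α (fun x => gradient (heatSemigroup d s h) x
                - gradient (heatSemigroup d t h) x) ≤ 2 * (H * δ ^ (ν / 2) * M d) := by
    refine Real.sSup_le ?_ (by positivity)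
    rintro r ⟨x, y, hxy, rfl⟩
    have hp : 0 < ‖x - y‖ := norm_pos_iff.2 (sub_ne_zero.2 hxy)
    rw [div_le_iff₀ (by positivity)]
    rcases le_total (√δ) ‖x - y‖ with hl | hl
    · refine (norm_sub_le _ _).trans ?_
      rw [norm_grad_sub, norm_grad_sub]
      have k : δ ^ ((α + ν) / 2) ≤ δ ^ (ν / 2) * ‖x - y‖ ^ α := by
        rw [show (α + ν) / 2 = ν / 2 + α / 2 by ring,
          Real.rpow_add_of_nonneg hδ0 (by linarith) (by linarith)]
        refine mul_le_mul_of_nonneg_left ?_ (Real.rpow_nonneg hδ0 _)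
        have : δ ^ (α / 2) = √δ ^ α := by
          rw [Real.sqrt_eq_rpow, ← Real.rpow_mul hδ0]; congr 1; ring
        rw [this]
        exact Real.rpow_le_rpow (Real.sqrt_nonneg _) hl hα.le
      have k2 := mul_le_mul_of_nonneg_left k (mul_nonneg hH0 hM)
      linarith [t2 x, t2 y]
    · have k : ‖x - y‖ ^ (α + ν) ≤ δ ^ (ν / 2) * ‖x - y‖ ^ α := by
        rw [Real.rpow_add hp, mul_comm]
        refine mul_le_mul_of_nonneg_right ?_ (by positivity)
        have : δ ^ (ν / 2) = √δ ^ ν := by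
          rw [Real.sqrt_eq_rpow, ← Real.rpow_mul hδ0]; congr 1; ring
        rw [this]
        exact Real.rpow_le_rpow hp.le hl hν.le
      have k2 := mul_le_mul_of_nonneg_left k (mul_nonneg hH0 hM)
      have e : ∀ a b c e : EuclideanSpace ℝ (Fin d), ‖a - b - (c - e)‖ ≤ ‖a - c‖ + ‖b - e‖ := by
        intro a b c e
        rw [sub_sub_sub_comm]
        exact norm_sub_le _ _
      refine (e _ _ _ _).trans ?_
      rw [norm_grad_sub, norm_grad_sub]
      linarith [t3 s hs x y, t3 t ht x y]
  have p1 : 0 ≤ δ ^ (ν / 2) := Real.rpow_nonneg hδ0 _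
  have p2 : 0 ≤ T ^ ((1 - ν) / 2) := Real.rpow_nonneg hT0 _
  have p3 : 0 ≤ T ^ (α / 2) := Real.rpow_nonneg hT0 _
  refine (add_le_add (add_le_add t1 s2) s3).trans ?_
  have q1 : 0 ≤ δ ^ (ν / 2) * (K + H) := by positivity
  have q2 : 0 ≤ M d * T ^ ((1 - ν) / 2) * δ ^ (ν / 2) * H := by positivity
  have q3 : 0 ≤ M d * (T ^ (α / 2) + 2) * δ ^ (ν / 2) * K := by positivity
  linarith

end HeatAux

/-- There is a constant `c > 0` such that for every differentiable
`h : ℝ^d → ℝ` with bounded `(α+ν)`-Hölder gradient and all `0 ≤ t ≤ t + ε ≤ T`,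
`|(P_{t+ε}h)(0) − (P_t h)(0)| + ‖∇(P_{t+ε}h) − ∇(P_t h)‖_∞ + [∇(P_{t+ε}h) − ∇(P_t h)]_α
  ≤ c ε^{(ν∧1)/2} (‖∇h‖_∞ + [∇h]_{α+ν})`;
in particular `t ↦ P_t h` is continuous from `[0,T]` into `D𝒞^α`. -/
theorem stmt_7 (d : ℕ) (hd : 1 ≤ d) (T : ℝ) (hT : 0 < T)
    (α ν : ℝ) (hα : 0 < α) (hν : 0 < ν) (hαν : α + ν < 1) :
    ∃ c : ℝ, 0 < c ∧
      ∀ h : EuclideanSpace ℝ (Fin d) → ℝ, Differentiable ℝ h →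
        (∃ C, ∀ x, ‖gradient h x‖ ≤ C) →
        (∃ C, ∀ x y, ‖gradient h x - gradient h y‖ ≤ C * ‖x - y‖ ^ (α + ν)) →
        (∀ t ε : ℝ, 0 ≤ t → 0 ≤ ε → t + ε ≤ T →
          |heatSemigroup d (t + ε) h 0 - heatSemigroup d t h 0|
            + supNorm (fun x => gradient (heatSemigroup d (t + ε) h) x
                - gradient (heatSemigroup d t h) x)
            + holderSem α (fun x => gradient (heatSemigroup d (t + ε) h) x
                - gradient (heatSemigroup d t h) x)
          ≤ c * ε ^ (min ν 1 / 2) * (supNorm (gradient h) + holderSem (α + ν) (gradient h))) ∧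
        (∀ t₀ ∈ Set.Icc (0 : ℝ) T, Filter.Tendsto
          (fun t => |heatSemigroup d t h 0 - heatSemigroup d t₀ h 0|
            + supNorm (fun x => gradient (heatSemigroup d t h) x
                - gradient (heatSemigroup d t₀ h) x)
            + holderSem α (fun x => gradient (heatSemigroup d t h) x
                - gradient (heatSemigroup d t₀ h) x))
          (nhdsWithin t₀ (Set.Icc (0 : ℝ) T)) (nhds 0)) := by
  refine ⟨HeatAux.M d * (T ^ ((1 - ν) / 2) + T ^ (α / 2) + 2) + 1, ?_, ?_⟩
  · have := HeatAux.M_nonneg d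
    positivity
  intro h hdiff hb hh
  obtain ⟨C, hC⟩ := hb
  obtain ⟨C', hC'⟩ := hh
  have hK : ∀ x, ‖fderiv ℝ h x‖ ≤ supNorm (gradient h) := by
    intro x
    rw [← HeatAux.norm_grad]
    exact le_ciSup (f := fun x => ‖gradient h x‖)
      ⟨C, by rintro _ ⟨y, rfl⟩; exact hC y⟩ x
  have hH0 : 0 ≤ holderSem (α + ν) (gradient h) := by
    refine Real.sSup_nonneg ?_
    rintro r ⟨x, y, _, rfl⟩
    positivity
  have hH : ∀ x y, ‖fderiv ℝ h x - fderiv ℝ h y‖ ≤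
      holderSem (α + ν) (gradient h) * ‖x - y‖ ^ (α + ν) := by
    intro x y
    rcases eq_or_ne x y with rfl | hxy
    · simp only [sub_self, norm_zero]; positivity
    have hp : 0 < ‖x - y‖ := norm_pos_iff.2 (sub_ne_zero.2 hxy)
    rw [← HeatAux.norm_grad_sub, ← div_le_iff₀ (by positivity)]
    refine le_csSup ⟨C', ?_⟩ ⟨x, y, hxy, rfl⟩
    rintro r ⟨u, v, huv, rfl⟩
    have hp : 0 < ‖u - v‖ := norm_pos_iff.2 (sub_ne_zero.2 huv)
    rw [div_le_iff₀ (by positivity)]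
    exact hC' u v
  refine ⟨fun t ε ht hε hT' => ?_, fun t₀ ht₀ => ?_⟩
  · have := HeatAux.main d T α ν hα hν hαν hdiff hK hH0 hH (s := t + ε) (t := t)
      (by linarith) ht (by rw [add_sub_cancel_left, abs_of_nonneg hε]; linarith)
    rw [add_sub_cancel_left, abs_of_nonneg hε] at this
    rwa [min_eq_left (by linarith : ν ≤ 1)]
  · have hcont : Continuous fun t : ℝ =>
        (HeatAux.M d * (T ^ ((1 - ν) / 2) + T ^ (α / 2) + 2) + 1) * |t - t₀| ^ (ν / 2) *
        (supNorm (gradient h) + holderSem (α + ν) (gradient h)) :=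
      (continuous_const.mul (Continuous.rpow_const (by fun_prop)
        fun _ => Or.inr (by linarith))).mul continuous_const
    have hlim := (hcont.tendsto t₀).mono_left (nhdsWithin_le_nhds (s := Set.Icc (0 : ℝ) T))
    simp only [sub_self, abs_zero, Real.zero_rpow (by linarith : ν / 2 ≠ 0), mul_zero,
      zero_mul] at hlim
    refine squeeze_zero' (Filter.Eventually.of_forall fun t => ?_) ?_ hlim
    · refine add_nonneg (add_nonneg (abs_nonneg _) (Real.iSup_nonneg fun _ => norm_nonneg _)) ?_
      refine Real.sSup_nonneg ?_
      rintro r ⟨x, y, _, rfl⟩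
      positivity
    · filter_upwards [self_mem_nhdsWithin] with t ht
      refine HeatAux.main d T α ν hα hν hαν hdiff hK hH0 hH ht.1 ht₀.1 ?_
      rw [abs_le]
      constructor <;> linarith [ht.1, ht.2, ht₀.1, ht₀.2]
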